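/- The A_1 Macdonald polynomial is the following explicit linear combination of Whittaker polynomials: for every integer l ≥ 0, ∑_{n=0}^{⌊l/2⌋} [ f_l(l−2n) / (q^2;q^2)_{l−2n} ] · W_{l−2n}(x) = P_l(x;t^2,q^2) in ℚ(q,t)[x, x^{−1}]. -/

import Mathlib

/-!
STATEMENT 12: The `A₁` Macdonald polynomial is the following explicit linear combination of
Whittaker polynomials: for every integer `l ≥ 0`,
`∑_{n=0}^{⌊l/2⌋} [f_l(l−2n)/(q²;q²)_{l−2n}] · W_{l−2n}(x) = P_l(x;t²,q²)` in `ℚ(q,t)[x,x⁻¹]`.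

We realize `ℚ(q,t)` as `RatFunc (RatFunc ℚ)` (inner variable `q`, outer variable `t`) and
Laurent polynomials in `x` as `LaurentPolynomial (RatFunc (RatFunc ℚ))`.
-/

noncomputable section

/-- The field `ℚ(q,t)`. -/
abbrev K : Type := RatFunc (RatFunc ℚ)

/-- The element `q`. -/
def q : K := RatFunc.C RatFunc.X

/-- The element `t`. -/
def t : K := RatFunc.X

/-- The q-Pochhammer symbol `(a;b)_n = ∏_{k=0}^{n-1} (1 - b^k a)`. -/
def poch (a b : K) (n : ℕ) : K := ∏ k ∈ Finset.range n, (1 - b ^ k * a)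

/-- The Gaussian binomial coefficient `binom(l,k)_{q²}`. -/
def qBinom (l k : ℕ) : K :=
  poch (q ^ 2) (q ^ 2) l / (poch (q ^ 2) (q ^ 2) k * poch (q ^ 2) (q ^ 2) (l - k))

/-- The Whittaker polynomial `W_l = ∑_{k=0}^{l} binom(l,k)_{q²} x^{l-2k}`. -/
def W (l : ℕ) : LaurentPolynomial K :=
  ∑ k ∈ Finset.range (l + 1),
    LaurentPolynomial.C (qBinom l k) * LaurentPolynomial.T ((l : ℤ) - 2 * k)

/-- The `A₁` Macdonald polynomial `P_l(x;t²,q²)` as a Laurent polynomial over `ℚ(q,t)`. -/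
def P (l : ℕ) : LaurentPolynomial K :=
  ∑ r ∈ Finset.range (l + 1),
    LaurentPolynomial.C
      (poch (q ^ (2 * l)) (q ^ (-2 : ℤ)) r * poch (t ^ 2) (q ^ 2) r /
        (poch (q ^ (2 * ((l : ℤ) - 1)) * t ^ 2) (q ^ (-2 : ℤ)) r
          * poch (q ^ 2) (q ^ 2) r))
    * LaurentPolynomial.T ((l : ℤ) - 2 * r)

/-- The eigenfunction `f_l` of the mutated Macdonald operator. -/
def f (l : ℕ) (n : ℤ) : K :=
  if 0 ≤ n ∧ n ≤ (l : ℤ) ∧ ((l : ℤ) - n) % 2 = 0 then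
    poch (q ^ 2) (q ^ 2) l * (q * t⁻¹) ^ (n - (l : ℤ)) /
      (poch (t ^ 2 * q ^ (n + (l : ℤ))) (q ^ 2) (((l : ℤ) - n).toNat / 2)
        * poch (q ^ (n - (l : ℤ))) (q ^ 2) (((l : ℤ) - n).toNat / 2))
  else 0

lemma q_ne_zero : q ≠ 0 := by
  unfold q
  simpa using (RatFunc.X_ne_zero (K := ℚ))

lemma t_ne_zero : t ≠ 0 := RatFunc.X_ne_zero

lemma qpow_ne (k : ℕ) (hk : k ≠ 0) : (1 : K) - (q ^ 2) ^ k ≠ 0 := by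
  intro h
  have h1 : (q ^ 2) ^ k = 1 := (sub_eq_zero.mp h).symm
  rw [← pow_mul] at h1
  unfold q at h1
  rw [← map_pow, ← map_one (RatFunc.C (K := RatFunc ℚ))] at h1
  have h2 : (RatFunc.X : RatFunc ℚ) ^ (2 * k) = 1 := RatFunc.C_injective h1
  rw [← RatFunc.algebraMap_X, ← map_pow, ← map_one (algebraMap (Polynomial ℚ) (RatFunc ℚ))] at h2
  have h3 := RatFunc.algebraMap_injective ℚ h2
  have h4 := congrArg Polynomial.natDegree h3
  simp at h4
  exact hk h4

lemma tq_ne (k : ℕ) : (1 : K) - t ^ 2 * (q ^ 2) ^ k ≠ 0 := by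
  intro h
  have h1 : t ^ 2 * (q ^ 2) ^ k = 1 := (sub_eq_zero.mp h).symm
  have h0 : (q ^ 2) ^ k ≠ 0 := pow_ne_zero _ (pow_ne_zero _ q_ne_zero)
  have h2 := congrArg RatFunc.intDegree h1
  have hq : RatFunc.intDegree ((q ^ 2) ^ k) = 0 := by
    unfold q
    rw [← map_pow, ← map_pow, RatFunc.intDegree_C]
  rw [RatFunc.intDegree_mul (pow_ne_zero _ t_ne_zero) h0, hq, pow_two,
    RatFunc.intDegree_mul t_ne_zero t_ne_zero] at h2
  unfold t at h2
  rw [RatFunc.intDegree_X, RatFunc.intDegree_one] at h2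
  omega

/-- Gaussian binomial by recursion. -/
def gb (p : K) : ℕ → ℕ → K
  | _, 0 => 1
  | 0, _ + 1 => 0
  | r + 1, n + 1 => p ^ (r - n) * gb p r n + gb p r (n + 1)

lemma gb_zero (p : K) (r : ℕ) : gb p r 0 = 1 := by cases r <;> rfl

lemma gb_succ (p : K) (r n : ℕ) :
    gb p (r + 1) (n + 1) = p ^ (r - n) * gb p r n + gb p r (n + 1) := rfl

lemma gb_gt (p : K) : ∀ r n : ℕ, r < n → gb p r n = 0
  | 0, 0, h => by omega
  | 0, _ + 1, _ => rfl
  | r + 1, 0, h => by omega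
  | r + 1, n + 1, h => by
    rw [gb_succ, gb_gt p r n (by omega), gb_gt p r (n + 1) (by omega)]; simp

lemma poch_zero (a b : K) : poch a b 0 = 1 := by simp [poch]

lemma poch_succ (a b : K) (n : ℕ) : poch a b (n + 1) = poch a b n * (1 - b ^ n * a) := by
  simp [poch, Finset.prod_range_succ]

lemma gb_poch (p : K) : ∀ r n k : ℕ, n + k = r →
    gb p r n * poch p p n * poch p p k = poch p p r := by
  intro r
  induction r with
  | zero =>
    intro n k h
    obtain rfl : n = 0 := by omega
    obtain rfl : k = 0 := by omega
    simp [gb_zero, poch_zero]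
  | succ r ih =>
    intro n k h
    rcases n with _ | n
    · obtain rfl : k = r + 1 := by omega
      simp [gb_zero, poch_zero]
    · rcases k with _ | k
      · obtain rfl : n = r := by omega
        have := ih n 0 (by omega)
        rw [gb_succ, gb_gt p n (n + 1) (by omega), poch_succ, Nat.sub_self]
        linear_combination (1 - p ^ n * p) * this
      · have h1 := ih n (k + 1) (by omega)
        have h2 := ih (n + 1) k (by omega)
        have e : r - n = k + 1 := by omega
        rw [gb_succ, e]
        have e1 : poch p p (r + 1) = poch p p r * (1 - p ^ (n + k + 1) * p) := by
          rw [poch_succ]; congr 3; congr 1; omega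
        have : (p ^ (k + 1) * gb p r n + gb p r (n + 1)) * poch p p (n + 1) * poch p p (k + 1)
          = p ^ (k + 1) * (1 - p ^ n * p) * (gb p r n * poch p p n * poch p p (k + 1))
            + (1 - p ^ k * p) * (gb p r (n + 1) * poch p p (n + 1) * poch p p k) := by
          rw [poch_succ p p n, poch_succ p p k]; ring
        rw [this, h1, h2, e1]
        ring

/-- Summand of the polynomial Chu-Vandermonde identity. -/
def Tm (p s A : K) (r n : ℕ) : K :=
  (-s) ^ n * (∏ j ∈ Finset.range n, p ^ j) * poch A p⁻¹ n * poch (s * A) p (r - n)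

lemma Tm_left (p s A : K) (r n : ℕ) (h : n ≤ r) :
    Tm p s A (r + 1) n = Tm p s A r n * (1 - p ^ (r - n) * (s * A)) := by
  unfold Tm
  rw [Nat.sub_add_comm h, poch_succ]; ring

lemma Tm_right (p s A : K) (r n : ℕ) :
    Tm p s A (r + 1) (n + 1) = Tm p s A r n * (-s * p ^ n * (1 - p⁻¹ ^ n * A)) := by
  unfold Tm
  rw [Nat.add_sub_add_right, poch_succ, Finset.prod_range_succ]; ring

lemma cv (p s A : K) (hp : p ≠ 0) (r : ℕ) :
    ∑ n ∈ Finset.range (r + 1), gb p r n * Tm p s A r n = poch s p r := by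
  induction r with
  | zero => simp [gb_zero, Tm, poch_zero]
  | succ r ih =>
    rw [Finset.sum_range_succ']
    have e : ∀ n ∈ Finset.range (r + 1), gb p (r + 1) (n + 1) * Tm p s A (r + 1) (n + 1)
        = p ^ (r - n) * gb p r n * Tm p s A (r + 1) (n + 1)
          + gb p r (n + 1) * Tm p s A (r + 1) (n + 1) := by
      intro n _; rw [gb_succ]; ring
    rw [Finset.sum_congr rfl e, Finset.sum_add_distrib, add_assoc]
    have e2 : ∑ n ∈ Finset.range (r + 1), gb p r (n + 1) * Tm p s A (r + 1) (n + 1)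
        + gb p (r + 1) 0 * Tm p s A (r + 1) 0
        = ∑ n ∈ Finset.range (r + 1), gb p r n * Tm p s A (r + 1) n := by
      rw [gb_zero, ← gb_zero p r,
        ← Finset.sum_range_succ' (fun n => gb p r n * Tm p s A (r + 1) n),
        Finset.sum_range_succ, gb_gt p r (r + 1) (by omega)]
      simp
    rw [e2, ← Finset.sum_add_distrib, poch_succ, ← ih, Finset.sum_mul]
    refine Finset.sum_congr rfl fun n hn => ?_
    have hn : n ≤ r := by simpa [Nat.lt_succ_iff] using hn
    rw [Tm_left p s A r n hn, Tm_right]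
    obtain ⟨k, rfl⟩ := Nat.exists_eq_add_of_le hn
    rw [Nat.add_sub_cancel_left]
    have : p ^ n * p⁻¹ ^ n = 1 := by rw [← mul_pow, mul_inv_cancel₀ hp, one_pow]
    linear_combination (gb p (n + k) n * Tm p s A (n + k) n * p ^ k * s * A) * this

lemma poch_down (p : K) (hp : p ≠ 0) (a n : ℕ) :
    poch (p ^ (a + n)) p⁻¹ n * poch p p a = poch p p (a + n) := by
  induction n generalizing a with
  | zero => simp [poch_zero]
  | succ n ih =>
    have h := ih (a + 1)
    rw [show a + 1 + n = a + (n + 1) by omega] at h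
    rw [← h, poch_succ, poch_succ]
    have : p⁻¹ ^ n * p ^ (a + (n + 1)) = p ^ a * p := by
      rw [pow_add, pow_succ, inv_pow]; field_simp
    rw [this]; ring

lemma poch_down_zero (p : K) (hp : p ≠ 0) (m n : ℕ) (h : m < n) :
    poch (p ^ m) p⁻¹ n = 0 := by
  unfold poch
  refine Finset.prod_eq_zero (Finset.mem_range.mpr h) ?_
  rw [inv_pow, inv_mul_cancel₀ (pow_ne_zero _ hp), sub_self]

lemma poch_neg (p : K) (hp : p ≠ 0) (n : ℕ) :
    poch (p⁻¹ ^ n) p n * ((-1) ^ n * p ^ n * ∏ j ∈ Finset.range n, p ^ j) = poch p p n := by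
  have h1 : poch (p⁻¹ ^ n) p n = ∏ j ∈ Finset.range n, (1 - p⁻¹ ^ (j + 1)) := by
    unfold poch
    rw [← Finset.prod_range_reflect]
    refine Finset.prod_congr rfl fun j hj => ?_
    have hj := Finset.mem_range.mp hj
    obtain ⟨k, rfl⟩ : ∃ k, n = j + 1 + k := ⟨n - (j + 1), by omega⟩
    rw [show j + 1 + k - 1 - j = k by omega, pow_add p⁻¹ (j + 1) k, mul_comm, mul_assoc, ← mul_pow,
      inv_mul_cancel₀ hp]
    simp
  have h2 : (-1) ^ n * p ^ n * ∏ j ∈ Finset.range n, p ^ j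
      = ∏ j ∈ Finset.range n, (-1 * p * p ^ j) := by
    rw [Finset.prod_mul_distrib, Finset.prod_const, Finset.card_range, mul_pow]
  rw [h1, h2, ← Finset.prod_mul_distrib]
  unfold poch
  refine Finset.prod_congr rfl fun j _ => ?_
  have : p⁻¹ ^ (j + 1) * (p ^ j * p) = 1 := by
    rw [← pow_succ, ← mul_pow, inv_mul_cancel₀ hp, one_pow]
  linear_combination this

lemma poch_split (a p : K) (u v : ℕ) :
    poch a p (u + v) = poch a p u * poch (a * p ^ u) p v := by
  unfold poch
  rw [Finset.prod_range_add]
  congr 1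
  refine Finset.prod_congr rfl fun j _ => ?_
  rw [pow_add]; ring

lemma poch_q_ne (n : ℕ) : poch (q ^ 2) (q ^ 2) n ≠ 0 := by
  unfold poch
  refine Finset.prod_ne_zero_iff.mpr fun j _ => ?_
  rw [← pow_succ]; exact qpow_ne _ (by omega)

lemma poch_tq_ne (a n : ℕ) : poch (t ^ 2 * (q ^ 2) ^ a) (q ^ 2) n ≠ 0 := by
  unfold poch
  refine Finset.prod_ne_zero_iff.mpr fun j _ => ?_
  rw [mul_left_comm, ← pow_add]; exact tq_ne _

lemma poch_rev (p s : K) (hp : p ≠ 0) (m r : ℕ) :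
    poch (p ^ ((((r + m : ℕ) : ℤ)) - 1) * s) p⁻¹ r = poch (s * p ^ m) p r := by
  unfold poch
  rw [← Finset.prod_range_reflect]
  refine Finset.prod_congr rfl fun j hj => ?_
  have hj := Finset.mem_range.mp hj
  obtain ⟨k, rfl⟩ : ∃ k, r = j + 1 + k := ⟨r - (j + 1), by omega⟩
  rw [show j + 1 + k - 1 - j = k by omega,
    show (((j + 1 + k + m : ℕ) : ℤ)) - 1 = ((k + (j + m) : ℕ) : ℤ) by push_cast; ring,
    zpow_natCast, pow_add p k, pow_add p j]
  have : p⁻¹ ^ k * p ^ k = 1 := by rw [← mul_pow, inv_mul_cancel₀ hp, one_pow]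
  linear_combination (- (p ^ j * p ^ m * s)) * this

lemma zq (k : ℤ) : q ^ (2 * k) = (q ^ 2) ^ k := by
  rw [zpow_mul]; norm_cast

lemma f_eq (l n : ℕ) (h : 2 * n ≤ l) :
    f l ((l : ℤ) - 2 * n) = poch (q ^ 2) (q ^ 2) l * (t ^ 2) ^ n * (q ^ 2)⁻¹ ^ n /
      (poch (t ^ 2 * (q ^ 2) ^ (l - n)) (q ^ 2) n * poch ((q ^ 2)⁻¹ ^ n) (q ^ 2) n) := by
  unfold f
  rw [if_pos (by omega)]
  have e1 : ((l : ℤ) - ((l : ℤ) - 2 * n)).toNat / 2 = n := by omega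
  have e2 : (l : ℤ) - 2 * n - l = 2 * (-(n : ℤ)) := by ring
  have e3 : (l : ℤ) - 2 * n + l = 2 * ((l - n : ℕ) : ℤ) := by omega
  have e4 : (q * t⁻¹) ^ (2 * (-(n : ℤ))) = (t ^ 2) ^ n * (q ^ 2)⁻¹ ^ n := by
    rw [zpow_mul, zpow_neg, zpow_natCast]
    rw [← inv_pow, ← mul_pow]
    congr 1
    rw [show (2 : ℤ) = ((2 : ℕ) : ℤ) from rfl, zpow_natCast, mul_pow, mul_inv, inv_pow, inv_inv,
      mul_comm]
  rw [e1, e2, e3, e4, zq, zq, zpow_natCast, zpow_neg, zpow_natCast, ← inv_pow]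
  ring

lemma term_eq (r m n : ℕ) (hr : n ≤ r) (hm : n ≤ m) :
    f (r + m) (((r + m : ℕ) : ℤ) - 2 * n) / poch (q ^ 2) (q ^ 2) (r + m - 2 * n)
        * qBinom (r + m - 2 * n) (r - n)
      = poch (q ^ 2) (q ^ 2) (r + m) / (poch (q ^ 2) (q ^ 2) r * poch (q ^ 2) (q ^ 2) m
          * poch (t ^ 2 * (q ^ 2) ^ m) (q ^ 2) r)
        * (gb (q ^ 2) r n * Tm (q ^ 2) (t ^ 2) ((q ^ 2) ^ m) r n) := by
  rw [f_eq _ _ (by omega)]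
  obtain ⟨u, rfl⟩ := Nat.exists_eq_add_of_le' hr
  obtain ⟨v, rfl⟩ := Nat.exists_eq_add_of_le' hm
  unfold qBinom Tm
  rw [show u + n + (v + n) - n = v + n + u by omega,
    show u + n + (v + n) - 2 * n = u + v by omega, show u + n - n = u by omega,
    show u + v - u = v by omega]
  have hp : q ^ 2 ≠ 0 := pow_ne_zero _ q_ne_zero
  have a := gb_poch (q ^ 2) (u + n) n u (by omega)
  have b := poch_down (q ^ 2) hp v n
  have c := poch_split (t ^ 2 * (q ^ 2) ^ (v + n)) (q ^ 2) u n
  rw [mul_assoc, ← pow_add] at c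
  have d := poch_neg (q ^ 2) hp n
  have n1 := poch_q_ne (u + n)
  have n2 := poch_q_ne (v + n)
  have n3 := poch_q_ne (u + v)
  have n4 := poch_q_ne u
  have n5 := poch_q_ne v
  have n6 := poch_q_ne n
  have n7 := poch_tq_ne (v + n + u) n
  have n8 := poch_tq_ne (v + n) u
  have i : (q ^ 2) ^ n * (q ^ 2)⁻¹ ^ n = 1 := by rw [← mul_pow, mul_inv_cancel₀ hp, one_pow]
  have n9 : poch ((q ^ 2)⁻¹ ^ n) (q ^ 2) n ≠ 0 := by
    intro h; rw [h, zero_mul] at d; exact n6 d.symm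
  rw [c, mul_comm (t ^ 2) ((q ^ 2) ^ (v + n))] at *
  rw [neg_pow]
  generalize poch (q ^ 2) (q ^ 2) (u + n + (v + n)) = L at *
  generalize hh : (∏ j ∈ Finset.range n, (q ^ 2) ^ j) = H at *
  generalize gb (q ^ 2) (u + n) n = G at *
  generalize poch (q ^ 2) (q ^ 2) (u + n) = X1 at *
  generalize poch (q ^ 2) (q ^ 2) (v + n) = X2 at *
  generalize poch (q ^ 2) (q ^ 2) (u + v) = X3 at *
  generalize poch (q ^ 2) (q ^ 2) u = X4 at *
  generalize poch (q ^ 2) (q ^ 2) v = X5 at *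
  generalize poch (q ^ 2) (q ^ 2) n = X6 at *
  generalize poch ((q ^ 2)⁻¹ ^ n) (q ^ 2) n = X9 at *
  generalize poch ((q ^ 2) ^ (v + n)) (q ^ 2)⁻¹ n = Y at *
  generalize poch ((q ^ 2) ^ (v + n) * t ^ 2) (q ^ 2) u = X8 at *
  generalize poch (t ^ 2 * (q ^ 2) ^ (v + n + u)) (q ^ 2) n = X7 at *
  generalize (q ^ 2)⁻¹ ^ n = I at *
  generalize (q ^ 2) ^ n = J at *
  generalize (-1 : K) ^ n = E at *
  generalize (t ^ 2) ^ n = S at *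
  subst a b d
  have hG : G ≠ 0 := by rintro rfl; simp at n1
  have hY : Y ≠ 0 := by rintro rfl; simp at n2
  have hE : E ≠ 0 := by rintro rfl; simp at n6
  have hJ : J ≠ 0 := by rintro rfl; simp at n6
  have hH : H ≠ 0 := by rintro rfl; simp at n6
  obtain rfl : I = J⁻¹ := eq_inv_of_mul_eq_one_right i
  field_simp

lemma reindex (M : Type) [AddCommMonoid M] (l : ℕ) (h : ℕ → ℕ → M) :
    ∑ n ∈ Finset.range (l / 2 + 1), ∑ k ∈ Finset.range (l - 2 * n + 1), h n k
      = ∑ r ∈ Finset.range (l + 1), ∑ n ∈ Finset.range (r + 1),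
          if r + n ≤ l then h n (r - n) else 0 := by
  simp_rw [← Finset.sum_filter]
  rw [Finset.sum_sigma', Finset.sum_sigma']
  refine Finset.sum_bij' (fun x _ => ⟨x.1 + x.2, x.1⟩) (fun x _ => ⟨x.2, x.1 - x.2⟩) ?_ ?_ ?_ ?_ ?_
  · rintro ⟨n, k⟩ hx
    simp only [Finset.mem_sigma, Finset.mem_range, Finset.mem_filter] at hx ⊢
    omega
  · rintro ⟨n, k⟩ hx
    simp only [Finset.mem_sigma, Finset.mem_range, Finset.mem_filter] at hx ⊢
    omega
  · rintro ⟨n, k⟩ hx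
    simp
  · rintro ⟨n, k⟩ hx
    simp only [Finset.mem_sigma, Finset.mem_range, Finset.mem_filter] at hx ⊢
    have : k + (n - k) = n := by omega
    simp [this]
  · rintro ⟨n, k⟩ hx
    simp

lemma coeff_eq (r m : ℕ) :
    (∑ n ∈ Finset.range (r + 1), if r + n ≤ r + m then
      f (r + m) (((r + m : ℕ) : ℤ) - 2 * n) / poch (q ^ 2) (q ^ 2) (r + m - 2 * n)
        * qBinom (r + m - 2 * n) (r - n) else 0)
      = poch (q ^ (2 * (r + m))) (q ^ (-2 : ℤ)) r * poch (t ^ 2) (q ^ 2) r /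
        (poch (q ^ (2 * (((r + m : ℕ) : ℤ) - 1)) * t ^ 2) (q ^ (-2 : ℤ)) r
          * poch (q ^ 2) (q ^ 2) r) := by
  have hp : q ^ 2 ≠ 0 := pow_ne_zero _ q_ne_zero
  have e : q ^ (-2 : ℤ) = (q ^ 2)⁻¹ := by rw [zpow_neg]; norm_cast
  rw [e, zq, poch_rev _ _ hp, pow_mul, ← cv (q ^ 2) (t ^ 2) ((q ^ 2) ^ m) hp r]
  have b := poch_down (q ^ 2) hp m r
  rw [add_comm m r] at b
  have n1 := poch_q_ne r
  have n2 := poch_q_ne m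
  have n3 := poch_tq_ne m r
  have key : ∀ n ∈ Finset.range (r + 1), (if r + n ≤ r + m then
      f (r + m) (((r + m : ℕ) : ℤ) - 2 * n) / poch (q ^ 2) (q ^ 2) (r + m - 2 * n)
        * qBinom (r + m - 2 * n) (r - n) else 0)
      = poch (q ^ 2) (q ^ 2) (r + m) / (poch (q ^ 2) (q ^ 2) r * poch (q ^ 2) (q ^ 2) m
          * poch (t ^ 2 * (q ^ 2) ^ m) (q ^ 2) r)
        * (gb (q ^ 2) r n * Tm (q ^ 2) (t ^ 2) ((q ^ 2) ^ m) r n) := by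
    intro n hn
    have hn := Finset.mem_range.mp hn
    split_ifs with h
    · exact term_eq r m n (by omega) (by omega)
    · unfold Tm
      rw [poch_down_zero _ hp m n (by omega)]
      simp
  rw [Finset.sum_congr rfl key, ← Finset.mul_sum, ← b]
  field_simp

/-- The Macdonald polynomial expanded in the Whittaker basis. -/
theorem macdonald_in_whittaker_basis (l : ℕ) :
    ∑ n ∈ Finset.range (l / 2 + 1),
        LaurentPolynomial.C (f l ((l : ℤ) - 2 * n) / poch (q ^ 2) (q ^ 2) (l - 2 * n))
          * W (l - 2 * n)
      = P l := by
  unfold W P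
  simp_rw [Finset.mul_sum]
  rw [reindex]
  refine Finset.sum_congr rfl fun r hr => ?_
  have hr := Finset.mem_range.mp hr
  obtain ⟨m, rfl⟩ : ∃ m, l = r + m := ⟨l - r, by omega⟩
  rw [← coeff_eq, map_sum, Finset.sum_mul]
  refine Finset.sum_congr rfl fun n hn => ?_
  have hn := Finset.mem_range.mp hn
  split_ifs with h
  · rw [map_mul, ← mul_assoc]
    congr 2
    omega
  · simp

end
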